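/- Let 1<p<∞. If w ∈ A_p^+(ℝ), then there exists ε > 0 with ε comparable to ‖w‖_{A_p^+(ℝ)}^{1-p'} (with implied constants depending only on p) such that w ∈ A_{p-ε}^+(ℝ) and ‖w‖_{A_{p-ε}^+(ℝ)} ≤ c ‖w‖_{A_p^+(ℝ)} for a constant c depending only on p. -/

import Mathlib

open MeasureTheory Set Filter
open scoped ENNReal
noncomputable section

/-- A weight on `ℝ`: an a.e. positive, locally integrable function. -/
def IsWeight (w : ℝ → ℝ) : Prop :=
  (∀ᵐ x : ℝ, 0 < w x) ∧ MeasureTheory.LocallyIntegrable w MeasureTheory.volume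

/-- `∫_a^b w` as a lower integral. -/
def lintIoc (w : ℝ → ℝ) (a b : ℝ) : ℝ≥0∞ :=
  ∫⁻ t in Set.Ioc a b, ENNReal.ofReal (w t)

/-- Average `(1/(b-a)) ∫_a^b w`. -/
def avgIoc (w : ℝ → ℝ) (a b : ℝ) : ℝ≥0∞ :=
  (ENNReal.ofReal (b - a))⁻¹ * lintIoc w a b

/-- The one-sided Muckenhoupt `A_r^+` characteristic:
`sup_{x, h>0} ((1/h)∫_{x-h}^x w) ((1/h)∫_x^{x+h} w^{1-r'})^{r-1}` with `r' = r/(r-1)`. -/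
def apPlusChar (r : ℝ) (w : ℝ → ℝ) : ℝ≥0∞ :=
  ⨆ (x : ℝ) (h : ℝ) (_ : 0 < h),
    avgIoc w (x - h) x *
      avgIoc (fun t => w t ^ (1 - r / (r - 1))) x (x + h) ^ (r - 1)


theorem open_comp_le (O : Set ℝ) (hO : IsOpen O) (a b : ℝ) (hab : O ⊆ Ioo a b)
    (μ ν : Measure ℝ)
    (H : ∀ c d : ℝ, c < d → c ∉ O → d ∉ O → Ioo c d ⊆ O → μ (Ioo c d) ≤ ν (Ioo c d)) :
    μ O ≤ ν O := by
  classical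
  let T : Set (ℝ × ℝ) := {P | P.1 < P.2 ∧ P.1 ∉ O ∧ P.2 ∉ O ∧ Ioo P.1 P.2 ⊆ O}
  have hdisj : T.PairwiseDisjoint (fun P => Ioo P.1 P.2) := by
    rintro ⟨c, d⟩ ⟨h1, h2, h3, h4⟩ ⟨c', d'⟩ ⟨h1', h2', h3', h4'⟩ hne
    refine Set.disjoint_left.2 ?_
    rintro x ⟨hx1, hx2⟩ ⟨hx3, hx4⟩
    dsimp only at *
    apply hne
    have e1 : c = c' := by
      rcases lt_trichotomy c c' with h | h | h
      · exact absurd (h4 ⟨h, by linarith⟩) h2'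
      · exact h
      · exact absurd (h4' ⟨h, by linarith⟩) h2
    have e2 : d = d' := by
      rcases lt_trichotomy d d' with h | h | h
      · exact absurd (h4' ⟨by linarith, h⟩) h3
      · exact h
      · exact absurd (h4 ⟨by linarith, h⟩) h3'
    rw [e1, e2]
  have hcount : T.Countable := by
    refine hdisj.countable_of_isOpen (fun _ _ => isOpen_Ioo) ?_
    rintro ⟨c, d⟩ ⟨h1, _⟩
    exact nonempty_Ioo.2 h1
  have hU : O = ⋃ P ∈ T, Ioo P.1 P.2 := by
    apply Subset.antisymm
    · intro x hx
      have hxab := hab hx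
      have hcl : IsClosed Oᶜ := hO.isClosed_compl
      have hc := (hcl.inter isClosed_Iic).csSup_mem (s := Oᶜ ∩ Iic x)
        ⟨a, fun h => lt_irrefl _ (hab h).1, hxab.1.le⟩ ⟨x, fun y hy => hy.2⟩
      have hd := (hcl.inter isClosed_Ici).csInf_mem (s := Oᶜ ∩ Ici x)
        ⟨b, fun h => lt_irrefl _ (hab h).2, hxab.2.le⟩ ⟨x, fun y hy => hy.2⟩
      set c := sSup (Oᶜ ∩ Iic x) with hcdef
      set d := sInf (Oᶜ ∩ Ici x) with hddef
      have hcx : c < x := lt_of_le_of_ne hc.2 (fun h => hc.1 (h ▸ hx))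
      have hdx : x < d := lt_of_le_of_ne hd.2 (fun h => hd.1 (h ▸ hx))
      refine mem_iUnion₂.2 ⟨(c, d), ⟨hcx.trans hdx, hc.1, hd.1, ?_⟩, hcx, hdx⟩
      rintro y ⟨hy1, hy2⟩
      dsimp only at hy1 hy2
      by_contra hy
      rcases le_total y x with h | h
      · exact absurd (le_csSup (s := Oᶜ ∩ Iic x) ⟨x, fun y hy => hy.2⟩ ⟨hy, h⟩) (not_le.2 hy1)
      · exact absurd (csInf_le (s := Oᶜ ∩ Ici x) ⟨x, fun y hy => hy.2⟩ ⟨hy, h⟩) (not_le.2 hy2)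
    · exact iUnion₂_subset fun P hP => hP.2.2.2
  rw [hU, measure_biUnion hcount hdisj (fun _ _ => measurableSet_Ioo),
    measure_biUnion hcount hdisj (fun _ _ => measurableSet_Ioo)]
  exact ENNReal.tsum_le_tsum fun P => H _ _ P.2.1 P.2.2.1 P.2.2.2.1 P.2.2.2.2

/-- Rising sun lemma, abstract form. -/
theorem rising_sun (s : ℝ → ℝ) (hs : LocallyIntegrable s volume)
    (a b lam : ℝ) (ν : Measure ℝ)
    (hM : ∀ c ∈ Ioc a b, ∫ t in a..c, s t ≤ lam * (c - a))
    (hν : ∀ c d : ℝ, a ≤ c → c < d → d ≤ b → (∀ x ∈ Ioo c d, lam * (d - x) ≤ ∫ t in x..d, s t) →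
      (∫ t in c..d, s t ≤ lam * (d - c)) →
      ∫⁻ t in Ioo c d, ENNReal.ofReal (s t) ≤ ν (Ioo c d)) :
    ∫⁻ t in Ioo a b ∩ {t | lam < s t}, ENNReal.ofReal (s t) ≤ ν (Ioo a b) := by
  have hii : ∀ x y, IntervalIntegrable s volume x y := fun x y => (hs.integrableOn_isCompact isCompact_uIcc).intervalIntegrable
  set G : ℝ → ℝ := fun x => (∫ t in a..x, s t) - lam * (x - a) with hG
  have hGd : ∀ x y, G y - G x = (∫ t in x..y, s t) - lam * (y - x) := by
    intro x y
    have := intervalIntegral.integral_interval_sub_left (hii a y) (hii a x)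
    simp only [hG]; rw [← this]; ring
  have hGc : Continuous G := by
    have : Continuous fun x => ∫ t in a..x, s t :=
      intervalIntegral.continuous_primitive hii a
    fun_prop
  set O : Set ℝ := ⋃ y ∈ Iic b, (Ioo a b ∩ (Iio y ∩ {x | G x < G y})) with hOd
  have hO : IsOpen O := by
    refine isOpen_biUnion fun y _ => isOpen_Ioo.inter (isOpen_Iio.inter ?_)
    exact isOpen_lt hGc continuous_const
  have hmem : ∀ x, x ∈ O ↔ x ∈ Ioo a b ∧ ∃ y, x < y ∧ y ≤ b ∧ G x < G y := by
    intro x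
    simp only [hOd, mem_iUnion₂, mem_inter_iff, mem_Iio, mem_Iic, mem_ofPred_eq]
    constructor
    · rintro ⟨y, h1, h2, h3, h4⟩; exact ⟨h2, y, h3, h1, h4⟩
    · rintro ⟨h2, y, h3, h1, h4⟩; exact ⟨y, h1, h2, h3, h4⟩
  have hOab : O ⊆ Ioo a b := fun x hx => ((hmem x).1 hx).1
  have hGa : G a = 0 := by simp [hG]
  have hae : ∀ᵐ x : ℝ, x ∈ Ioo a b ∩ {t | lam < s t} → x ∈ O := by
    filter_upwards [_root_.LocallyIntegrable.ae_hasDerivAt_integral hs] with x hx hx2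
    by_contra hxO
    have hd : HasDerivAt G (s x - lam) x := by
      have h1 := hx a
      have h2 : HasDerivAt (fun x : ℝ => lam * (x - a)) lam x := by
        simpa using ((hasDerivAt_id x).sub_const a).const_mul lam
      exact h1.sub h2
    have hpos : 0 < s x - lam := sub_pos.2 hx2.2
    have h3 := hd.hasDerivWithinAt (s := Ioi x)
    rw [hasDerivWithinAt_iff_tendsto_slope' (by simp)] at h3
    have h4 := h3.eventually (lt_mem_nhds hpos)
    have h5 : ∀ᶠ y in nhdsWithin x (Ioi x), y ∈ Ioo x b := Ioo_mem_nhdsGT hx2.1.2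
    obtain ⟨y, hy1, hy2⟩ := (h4.and h5).exists
    apply hxO
    refine (hmem x).2 ⟨hx2.1, y, hy2.1, hy2.2.le, ?_⟩
    rw [slope_def_field] at hy1
    have := (div_pos_iff_of_pos_right (sub_pos.2 hy2.1)).1 hy1
    linarith
  have hcomp : ∀ c d : ℝ, c < d → c ∉ O → d ∉ O → Ioo c d ⊆ O →
      (volume.withDensity fun t => ENNReal.ofReal (s t)) (Ioo c d) ≤ ν (Ioo c d) := by
    intro c d hcd hc hd hI
    rw [withDensity_apply _ measurableSet_Ioo]
    have hcl : Icc c d ⊆ Icc a b := by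
      rw [← closure_Ioo hcd.ne]
      exact closure_minimal (hI.trans (hOab.trans Ioo_subset_Icc_self)) isClosed_Icc
    have hca := (hcl (left_mem_Icc.2 hcd.le)).1
    have hdb := (hcl (right_mem_Icc.2 hcd.le)).2
    refine hν c d hca hcd hdb ?_ ?_
    · intro x hx
      obtain ⟨y, hy, hymax⟩ := isCompact_Icc.exists_isMaxOn (s := Icc x b)
        ⟨x, le_refl _, hx.2.le.trans hdb⟩ hGc.continuousOn
      have hyle : ∀ z ∈ Icc x b, G z ≤ G y := fun z hz => hymax hz
      have hyd : d ≤ y := by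
        by_contra hlt
        push Not at hlt
        have := (hmem y).1 (hI ⟨lt_of_lt_of_le hx.1 hy.1, hlt⟩)
        obtain ⟨_, z, hz1, hz2, hz3⟩ := this
        exact absurd (hyle z ⟨hy.1.trans hz1.le, hz2⟩) (not_le.2 hz3)
      have h1 : G y ≤ G d := by
        rcases eq_or_lt_of_le hyd with h | h
        · rw [h]
        · by_contra hlt
          exact hd ((hmem d).2 ⟨⟨lt_of_le_of_lt hca hcd, lt_of_lt_of_le h hy.2⟩, y, h, hy.2,
            not_le.1 hlt⟩)
      have h2 := hyle x ⟨le_refl _, hx.2.le.trans hdb⟩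
      have := hGd x d
      linarith
    · have : G d ≤ G c := by
        rcases eq_or_lt_of_le hca with h | h
        · rw [← h, hGa]
          have := hM d ⟨lt_of_le_of_lt hca hcd, hdb⟩
          simp only [hG]; linarith
        · by_contra hlt
          exact hc ((hmem c).2 ⟨⟨h, lt_of_lt_of_le hcd hdb⟩, d, hcd, hdb, not_le.1 hlt⟩)
      have := hGd c d
      linarith
  have hfin := open_comp_le O hO a b hOab _ ν hcomp
  rw [withDensity_apply _ hO.measurableSet] at hfin
  calc _ ≤ ∫⁻ t in O, ENNReal.ofReal (s t) := by
        apply lintegral_mono_set'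
        exact hae
    _ ≤ ν O := hfin
    _ ≤ _ := measure_mono hOab

theorem absorb_half (I X : ℝ≥0∞) (hIfin : I ≠ ∞)
    (hsum : I ≤ X + ENNReal.ofReal (1 / 2) * I) : I ≤ 2 * X := by
  by_cases hXt : X = ∞
  · rw [hXt]; simp
  lift I to NNReal using hIfin
  lift X to NNReal using hXt
  have h12 : ENNReal.ofReal (1 / 2) = ((1 / 2 : NNReal) : ℝ≥0∞) := by
    rw [ENNReal.ofReal]; congr 1
    ext; simp
  rw [h12] at hsum
  have hs2 : I ≤ X + 1 / 2 * I := by exact_mod_cast hsum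
  have : I ≤ 2 * X := by
    have h := NNReal.coe_le_coe.2 hs2
    push_cast at h
    apply NNReal.coe_le_coe.1
    push_cast
    linarith
  exact_mod_cast this

theorem abstract_RH {α : Type*} [MeasurableSpace α] (μ : Measure α) [IsFiniteMeasure μ]
    (f : α → ℝ) (hf : Measurable f) (hf0 : ∀ x, 0 ≤ f x) (N : ℝ) (hN : ∀ x, f x ≤ N)
    (M β δ : ℝ) (hM : 0 < M) (hβ : 0 < β) (hδ : 0 < δ)
    (hsmall : 2 * δ * (β⁻¹) ^ (1 + δ) ≤ 1 / 2)
    (H : ∀ lam, M ≤ lam → ∫⁻ x in {x | lam < f x}, ENNReal.ofReal (f x) ∂μ ≤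
      2 * ENNReal.ofReal lam * μ {x | β * lam < f x}) :
    ∫⁻ x, ENNReal.ofReal (f x ^ (1 + δ)) ∂μ ≤
      2 * (ENNReal.ofReal (M ^ δ) * ∫⁻ x, ENNReal.ofReal (f x) ∂μ) := by
  set ν : Measure α := μ.withDensity (fun x => ENNReal.ofReal (f x)) with hν
  have hfm : Measurable fun x => ENNReal.ofReal (f x) := hf.ennreal_ofReal
  set I := ∫⁻ x, ENNReal.ofReal (f x ^ (1 + δ)) ∂μ with hI
  have hIfin : I ≠ ∞ := by
    have : I ≤ ∫⁻ x, ENNReal.ofReal (N ^ (1 + δ)) ∂μ :=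
      lintegral_mono fun x => ENNReal.ofReal_le_ofReal
        (Real.rpow_le_rpow (hf0 x) (hN x) (by linarith))
    refine ne_top_of_le_ne_top ?_ this
    rw [lintegral_const]
    exact ENNReal.mul_ne_top ENNReal.ofReal_ne_top (measure_ne_top _ _)
  have hI1 : I = ∫⁻ x, ENNReal.ofReal (f x ^ δ) ∂ν := by
    rw [hν, lintegral_withDensity_eq_lintegral_mul _ hfm (hf.pow_const δ).ennreal_ofReal, hI]
    refine lintegral_congr fun x => ?_
    rw [Pi.mul_apply, ← ENNReal.ofReal_mul (hf0 x)]
    congr 1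
    rcases eq_or_lt_of_le (hf0 x) with h | h
    · rw [← h, Real.zero_rpow (by linarith), zero_mul]
    · rw [Real.rpow_add h, Real.rpow_one]
  have hνset : ∀ t, ν {x | t < f x} = ∫⁻ x in {x | t < f x}, ENNReal.ofReal (f x) ∂μ := fun t =>
    withDensity_apply _ (measurableSet_lt measurable_const hf)
  have hνu : ν univ = ∫⁻ x, ENNReal.ofReal (f x) ∂μ := by
    rw [hν, withDensity_apply _ MeasurableSet.univ, Measure.restrict_univ]
  have hlow : ENNReal.ofReal δ * ∫⁻ t in Ioo 0 M, ν {x | t < f x} * ENNReal.ofReal (t ^ (δ - 1)) ≤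
      ENNReal.ofReal (M ^ δ) * ∫⁻ x, ENNReal.ofReal (f x) ∂μ := by
    have h1 := lintegral_rpow_eq_lintegral_meas_lt_mul ν (f := fun x => min (f x) M)
      (Eventually.of_forall fun x => le_min (hf0 x) hM.le) (hf.min measurable_const).aemeasurable hδ
    calc _ = ENNReal.ofReal δ *
        ∫⁻ t in Ioo 0 M, ν {x | t < min (f x) M} * ENNReal.ofReal (t ^ (δ - 1)) := by
          congr 1
          refine setLIntegral_congr_fun measurableSet_Ioo fun t ht => ?_
          simp only [lt_min_iff, ht.2, and_true]
      _ ≤ ENNReal.ofReal δ *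
        ∫⁻ t in Ioi 0, ν {x | t < min (f x) M} * ENNReal.ofReal (t ^ (δ - 1)) := by
          gcongr
          exact Ioo_subset_Ioi_self
      _ = ∫⁻ x, ENNReal.ofReal ((min (f x) M) ^ δ) ∂ν := h1.symm
      _ ≤ ∫⁻ x, ENNReal.ofReal (M ^ δ) ∂ν := lintegral_mono fun x => ENNReal.ofReal_le_ofReal
          (Real.rpow_le_rpow (le_min (hf0 x) hM.le) (min_le_right _ _) hδ.le)
      _ = _ := by rw [lintegral_const, hνu]
  have hhigh : ENNReal.ofReal δ * ∫⁻ t in Ici M, ν {x | t < f x} * ENNReal.ofReal (t ^ (δ - 1)) ≤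
      ENNReal.ofReal (1 / 2) * I := by
    have h1 := lintegral_rpow_eq_lintegral_meas_lt_mul μ (f := fun x => β⁻¹ * f x)
      (Eventually.of_forall fun x => mul_nonneg (inv_nonneg.2 hβ.le) (hf0 x))
      (hf.const_mul _).aemeasurable (p := 1 + δ) (by linarith)
    have h2 : ∫⁻ x, ENNReal.ofReal ((β⁻¹ * f x) ^ (1 + δ)) ∂μ
        = ENNReal.ofReal ((β⁻¹) ^ (1 + δ)) * I := by
      rw [hI, ← lintegral_const_mul _ (hf.pow_const _).ennreal_ofReal]
      refine lintegral_congr fun x => ?_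
      rw [Real.mul_rpow (inv_nonneg.2 hβ.le) (hf0 x), ENNReal.ofReal_mul (by positivity)]
    set J := ∫⁻ t in Ioi 0, μ {x | t < β⁻¹ * f x} * ENNReal.ofReal (t ^ (1 + δ - 1)) with hJ
    have h3 : J ≤ ENNReal.ofReal ((β⁻¹) ^ (1 + δ)) * I := by
      rw [← h2, h1]
      refine le_mul_of_one_le_left zero_le ?_
      rw [ENNReal.one_le_ofReal]; linarith
    have h4 : ∫⁻ t in Ici M, ν {x | t < f x} * ENNReal.ofReal (t ^ (δ - 1)) ≤ 2 * J := by
      have : ∫⁻ t in Ici M, ν {x | t < f x} * ENNReal.ofReal (t ^ (δ - 1)) ≤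
          ∫⁻ t in Ici M, 2 * (μ {x | t < β⁻¹ * f x} * ENNReal.ofReal (t ^ (1 + δ - 1))) := by
        refine setLIntegral_mono' measurableSet_Ici fun t ht => ?_
        have ht0 : 0 < t := lt_of_lt_of_le hM ht
        have e : {x | t < β⁻¹ * f x} = {x | β * t < f x} := by
          ext x
          simp only [mem_ofPred_eq]
          rw [lt_inv_mul_iff₀ hβ]
        rw [e, hνset]
        calc _ ≤ 2 * ENNReal.ofReal t * μ {x | β * t < f x} * ENNReal.ofReal (t ^ (δ - 1)) := by
              gcongr
              exact H t ht
          _ = 2 * (μ {x | β * t < f x} * (ENNReal.ofReal t * ENNReal.ofReal (t ^ (δ - 1)))) := by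
              ring
          _ = _ := by
              rw [← ENNReal.ofReal_mul ht0.le]
              congr 4
              rw [show 1 + δ - 1 = 1 + (δ - 1) by ring, Real.rpow_add ht0, Real.rpow_one]
      refine this.trans ?_
      rw [lintegral_const_mul' _ _ (by simp)]
      refine mul_le_mul_right (lintegral_mono_set ?_) _
      exact fun t ht => lt_of_lt_of_le hM ht
    calc _ ≤ ENNReal.ofReal δ * (2 * (ENNReal.ofReal ((β⁻¹) ^ (1 + δ)) * I)) := by
          gcongr
          exact h4.trans (by gcongr)
      _ = ENNReal.ofReal (2 * δ * (β⁻¹) ^ (1 + δ)) * I := by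
          rw [ENNReal.ofReal_mul (by positivity), ENNReal.ofReal_mul (by positivity)]
          simp only [ENNReal.ofReal_ofNat]
          ring
      _ ≤ _ := by gcongr
  have hsum : I ≤ ENNReal.ofReal (M ^ δ) * (∫⁻ x, ENNReal.ofReal (f x) ∂μ)
      + ENNReal.ofReal (1 / 2) * I := by
    have h1 := lintegral_rpow_eq_lintegral_meas_lt_mul ν (f := f)
      (Eventually.of_forall hf0) hf.aemeasurable hδ
    have hU : Ioi (0 : ℝ) = Ioo 0 M ∪ Ici M := (Ioo_union_Ici_eq_Ioi hM).symm
    calc I = _ := hI1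
      _ = _ := h1
      _ ≤ ENNReal.ofReal δ * ((∫⁻ t in Ioo 0 M, ν {x | t < f x} * ENNReal.ofReal (t ^ (δ - 1))) +
          ∫⁻ t in Ici M, ν {x | t < f x} * ENNReal.ofReal (t ^ (δ - 1))) := by
          gcongr
          rw [hU]
          exact lintegral_union_le _ _ _
      _ ≤ _ := by
          rw [mul_add]
          gcongr
  set X := ENNReal.ofReal (M ^ δ) * (∫⁻ x, ENNReal.ofReal (f x) ∂μ) with hX
  exact absorb_half I X hIfin hsum

theorem w_bound (w s : ℝ → ℝ) (hw : LocallyIntegrable w volume) (hw0 : ∀ x, 0 < w x)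
    (A K : ℝ) (hK : 0 < K)
    (AP : ∀ x h : ℝ, 0 < h →
      (∫ t in (x - h)..x, w t) * (∫ t in x..(x + h), s t) ^ K ≤ A * h * h ^ K)
    (c d lam : ℝ) (hcd : c < d) (hl : 0 < lam)
    (hx : ∀ x ∈ Ioo c d, lam * (d - x) ≤ ∫ t in x..d, s t) :
    ∫ t in c..d, w t ≤ A * lam ^ (-K) * (d - c) := by
  have hii : ∀ x y, IntervalIntegrable w volume x y :=
    fun x y => (hw.integrableOn_isCompact isCompact_uIcc).intervalIntegrable
  have hstep : ∀ n : ℕ, ∫ t in c..(d - (d - c) / 2 ^ n), w t ≤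
      A * lam ^ (-K) * ((d - (d - c) / 2 ^ n) - c) := by
    intro n
    induction n with
    | zero => simp
    | succ n ih =>
      set h := (d - c) / 2 ^ (n + 1) with hh
      have hpos : 0 < h := by have := sub_pos.2 hcd; positivity
      have e : (d - c) / 2 ^ n = 2 * h := by rw [hh, pow_succ]; field_simp
      rw [e] at ih
      have hhd : 2 * h ≤ d - c := by
        rw [← e]
        exact div_le_self (sub_pos.2 hcd).le (one_le_pow₀ (by norm_num))
      have h1 := AP (d - h) h hpos
      rw [show d - h - h = d - 2 * h by ring, show d - h + h = d by ring] at h1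
      have h2 := hx (d - h) ⟨by linarith, by linarith⟩
      rw [show d - (d - h) = h by ring] at h2
      have hwn : 0 ≤ ∫ t in (d - 2 * h)..(d - h), w t :=
        intervalIntegral.integral_nonneg (by linarith) fun t _ => (hw0 t).le
      have h3 : (∫ t in (d - 2 * h)..(d - h), w t) * (lam * h) ^ K ≤ A * h * h ^ K :=
        (mul_le_mul_of_nonneg_left (Real.rpow_le_rpow (by positivity) h2 hK.le) hwn).trans h1
      have h4 : (∫ t in (d - 2 * h)..(d - h), w t) ≤ A * lam ^ (-K) * h := by
        rw [Real.mul_rpow hl.le hpos.le, ← mul_assoc] at h3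
        have h5 := le_of_mul_le_mul_right h3 (Real.rpow_pos_of_pos hpos K)
        rw [Real.rpow_neg hl.le]
        have : 0 < lam ^ K := Real.rpow_pos_of_pos hl K
        calc _ ≤ A * h / lam ^ K := by rw [le_div_iff₀ this]; exact h5
          _ = _ := by field_simp
      rw [← intervalIntegral.integral_add_adjacent_intervals (hii c (d - 2 * h))
        (hii (d - 2 * h) (d - h))]
      calc _ ≤ A * lam ^ (-K) * (d - 2 * h - c) + A * lam ^ (-K) * h := add_le_add ih h4
        _ = _ := by ring
  have hlim : Tendsto (fun n : ℕ => d - (d - c) / 2 ^ n) atTop (nhds d) := by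
    have : Tendsto (fun n : ℕ => (d - c) * ((1 / 2 : ℝ)) ^ n) atTop (nhds 0) := by
      simpa using (tendsto_pow_atTop_nhds_zero_of_lt_one (r := (1 / 2 : ℝ)) (by norm_num)
        (by norm_num)).const_mul (d - c)
    have h2 := this.const_sub d
    simp only [sub_zero] at h2
    refine h2.congr fun n => ?_
    rw [one_div, inv_pow]; rfl
  have hc1 : Continuous fun x => ∫ t in c..x, w t := intervalIntegral.continuous_primitive hii c
  have hc2 : Continuous fun x : ℝ => A * lam ^ (-K) * (x - c) := by fun_prop
  exact le_of_tendsto_of_tendsto' ((hc1.tendsto d).comp hlim) ((hc2.tendsto d).comp hlim) hstep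

theorem lint_Ioc (f : ℝ → ℝ) (hf : LocallyIntegrable f volume) (hf0 : ∀ x, 0 < f x) (c d : ℝ)
    (hcd : c ≤ d) :
    ∫⁻ t in Ioc c d, ENNReal.ofReal (f t) = ENNReal.ofReal (∫ t in c..d, f t) := by
  rw [intervalIntegral.integral_of_le hcd, ofReal_integral_eq_lintegral_ofReal]
  · exact (hf.integrableOn_isCompact isCompact_Icc).mono_set Ioc_subset_Icc_self
  · exact Eventually.of_forall fun t => (hf0 t).le

theorem lint_Ioo (f : ℝ → ℝ) (hf : LocallyIntegrable f volume) (hf0 : ∀ x, 0 < f x) (c d : ℝ)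
    (hcd : c ≤ d) :
    ∫⁻ t in Ioo c d, ENNReal.ofReal (f t) = ENNReal.ofReal (∫ t in c..d, f t) := by
  rw [← lint_Ioc f hf hf0 c d hcd]
  exact setLIntegral_congr Ioo_ae_eq_Ioc

theorem level_set (w s : ℝ → ℝ) (hw : LocallyIntegrable w volume) (hw0 : ∀ x, 0 < w x)
    (hs : LocallyIntegrable s volume) (hs0 : ∀ x, 0 < s x) (hsm : Measurable s)
    (A K β : ℝ) (hK : 0 < K) (hA : 0 < A) (hβ : 0 < β) (hβA : β ^ (-K) = 2 * A)
    (hws : ∀ x, w x = s x ^ (-K))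
    (AP : ∀ x h : ℝ, 0 < h →
      (∫ t in (x - h)..x, w t) * (∫ t in x..(x + h), s t) ^ K ≤ A * h * h ^ K)
    (a b lam : ℝ) (hl : 0 < lam)
    (hM : ∀ c ∈ Ioc a b, ∫ t in a..c, s t ≤ lam * (c - a)) :
    ∫⁻ t in Ioo a b ∩ {t | lam < s t}, ENNReal.ofReal (s t) ≤
      2 * ENNReal.ofReal lam * volume (Ioo a b ∩ {t | β * lam < s t}) := by
  have hms : MeasurableSet {t | β * lam < s t} := measurableSet_lt measurable_const hsm
  have key := rising_sun s hs a b lam ((2 * ENNReal.ofReal lam) • volume.restrict {t | β * lam < s t})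
    hM ?_
  · rwa [Measure.smul_apply, Measure.restrict_apply measurableSet_Ioo, smul_eq_mul] at key
  intro c d hac hcd hdb h1 h2
  rw [Measure.smul_apply, Measure.restrict_apply measurableSet_Ioo, smul_eq_mul,
    lint_Ioo s hs hs0 c d hcd.le]
  have hwb := w_bound w s hw hw0 A K hK AP c d lam hcd hl h1
  set G := Ioo c d ∩ {t | β * lam < s t} with hG
  set E := Ioo c d \ {t | β * lam < s t} with hE
  have hEm : MeasurableSet E := measurableSet_Ioo.diff hms
  have hEb : ENNReal.ofReal (2 * A * lam ^ (-K)) * volume E ≤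
      ENNReal.ofReal (A * lam ^ (-K) * (d - c)) := by
    calc _ = ∫⁻ t in E, ENNReal.ofReal (2 * A * lam ^ (-K)) := by
          rw [setLIntegral_const]
      _ ≤ ∫⁻ t in E, ENNReal.ofReal (w t) := by
          refine setLIntegral_mono' hEm fun t ht => ENNReal.ofReal_le_ofReal ?_
          have : s t ≤ β * lam := not_lt.1 ht.2
          rw [hws, ← hβA, ← Real.mul_rpow hβ.le hl.le]
          exact Real.rpow_le_rpow_of_nonpos (hs0 t) this (by linarith)
      _ ≤ ∫⁻ t in Ioo c d, ENNReal.ofReal (w t) := lintegral_mono_set sdiff_subset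
      _ = ENNReal.ofReal (∫ t in c..d, w t) := lint_Ioo w hw hw0 c d hcd.le
      _ ≤ _ := ENNReal.ofReal_le_ofReal hwb
  have hEv : 2 * volume E ≤ ENNReal.ofReal (d - c) := by
    have hq : 0 < A * lam ^ (-K) := mul_pos hA (Real.rpow_pos_of_pos hl _)
    rw [mul_assoc, ENNReal.ofReal_mul (by norm_num), ENNReal.ofReal_mul hq.le,
      ENNReal.ofReal_ofNat, mul_comm (2 : ℝ≥0∞), mul_assoc] at hEb
    exact (ENNReal.mul_le_mul_iff_right (ENNReal.ofReal_pos.2 hq).ne' ENNReal.ofReal_ne_top).1 hEb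
  have hsum : volume G + volume E = ENNReal.ofReal (d - c) := by
    rw [hG, hE, measure_inter_add_sdiff _ hms, Real.volume_Ioo]
  have hEfin : volume E ≠ ∞ := by
    refine ne_top_of_le_ne_top ENNReal.ofReal_ne_top (hsum ▸ le_add_self)
  have hfin : ENNReal.ofReal (d - c) ≤ 2 * volume G := by
    have h3 : 2 * ENNReal.ofReal (d - c) ≤ 2 * volume G + ENNReal.ofReal (d - c) := by
      conv_lhs => rw [← hsum, mul_add]
      gcongr
    rw [two_mul] at h3
    exact (ENNReal.add_le_add_iff_right ENNReal.ofReal_ne_top).1 h3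
  calc _ ≤ ENNReal.ofReal (lam * (d - c)) := ENNReal.ofReal_le_ofReal h2
    _ = ENNReal.ofReal lam * ENNReal.ofReal (d - c) := ENNReal.ofReal_mul hl.le
    _ ≤ ENNReal.ofReal lam * (2 * volume G) := by gcongr
    _ = _ := by ring

/-- one-sided reverse Hölder -/
theorem rev_holder (w s : ℝ → ℝ) (hw : LocallyIntegrable w volume) (hw0 : ∀ x, 0 < w x)
    (hs : LocallyIntegrable s volume) (hs0 : ∀ x, 0 < s x) (hsm : Measurable s)
    (A K β : ℝ) (hK : 0 < K) (hA : 0 < A) (hβ : 0 < β) (hβ1 : β ≤ 1) (hβA : β ^ (-K) = 2 * A)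
    (hws : ∀ x, w x = s x ^ (-K))
    (AP : ∀ x h : ℝ, 0 < h →
      (∫ t in (x - h)..x, w t) * (∫ t in x..(x + h), s t) ^ K ≤ A * h * h ^ K)
    (δ : ℝ) (hδ : 0 < δ) (hsmall : 2 * δ * (β⁻¹) ^ (1 + δ) ≤ 1 / 2)
    (a b M : ℝ) (hM0 : 0 < M)
    (hM : ∀ c ∈ Ioc a b, ∫ t in a..c, s t ≤ M * (c - a)) :
    ∫⁻ t in Ioo a b, ENNReal.ofReal (s t ^ (1 + δ)) ≤
      2 * (ENNReal.ofReal (M ^ δ) * ∫⁻ t in Ioo a b, ENNReal.ofReal (s t)) := by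
  have hfN : ∀ n : ℕ, ∫⁻ t in Ioo a b, ENNReal.ofReal ((min (s t) n) ^ (1 + δ)) ≤
      2 * (ENNReal.ofReal (M ^ δ) * ∫⁻ t in Ioo a b, ENNReal.ofReal (s t)) := by
    intro n
    have := abstract_RH (volume.restrict (Ioo a b)) (fun t => min (s t) n)
      (hsm.min measurable_const) (fun t => le_min (hs0 t).le (Nat.cast_nonneg n)) n
      (fun t => min_le_right _ _) M β δ hM0 hβ hδ hsmall ?_
    · refine this.trans ?_
      gcongr
      exact min_le_left _ _
    intro lam hlam
    have hl : 0 < lam := lt_of_lt_of_le hM0 hlam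
    rcases lt_or_ge lam n with hn | hn
    · have e1 : {x | lam < min (s x) (n : ℝ)} = {x | lam < s x} := by
        ext x; simp [hn]
      have hn2 : β * lam < n := lt_of_le_of_lt (mul_le_of_le_one_left hl.le hβ1) hn
      have e2 : {x | β * lam < min (s x) (n : ℝ)} = {x | β * lam < s x} := by
        ext x; simp [hn2]
      rw [e1, e2, Measure.restrict_restrict (measurableSet_lt measurable_const hsm),
        Measure.restrict_apply (measurableSet_lt measurable_const hsm), inter_comm,
        inter_comm {x | β * lam < s x}]
      have hL := level_set w s hw hw0 hs hs0 hsm A K β hK hA hβ hβA hws AP a b lam hl ?_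
      · refine le_trans (lintegral_mono fun t => ENNReal.ofReal_le_ofReal (min_le_left _ _)) hL
      · intro c hc
        refine (hM c hc).trans ?_
        exact mul_le_mul_of_nonneg_right hlam (by linarith [hc.1])
    · have e1 : {x | lam < min (s x) (n : ℝ)} = ∅ := by
        ext x; simp [hn]
      rw [e1]; simp
  have hmono : ∫⁻ t in Ioo a b, ENNReal.ofReal (s t ^ (1 + δ)) =
      ∫⁻ t in Ioo a b, ⨆ n : ℕ, ENNReal.ofReal ((min (s t) n) ^ (1 + δ)) := by
    refine lintegral_congr fun t => le_antisymm ?_ ?_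
    · obtain ⟨n, hn⟩ := exists_nat_ge (s t)
      refine le_iSup_of_le n ?_
      rw [min_eq_left hn]
    · refine iSup_le fun n => ENNReal.ofReal_le_ofReal ?_
      exact Real.rpow_le_rpow (le_min (hs0 t).le (Nat.cast_nonneg n)) (min_le_left _ _)
        (by linarith)
  rw [hmono, lintegral_iSup]
  · exact iSup_le hfN
  · exact fun n => ((hsm.min measurable_const).pow_const _).ennreal_ofReal
  · intro m n hmn t
    refine ENNReal.ofReal_le_ofReal ?_
    exact Real.rpow_le_rpow (le_min (hs0 t).le (Nat.cast_nonneg m))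
      (min_le_min le_rfl (by exact_mod_cast hmn)) (by linarith)

theorem choose_a (w : ℝ → ℝ) (hw : LocallyIntegrable w volume) (hw0 : ∀ x, 0 < w x)
    (x h : ℝ) (hh : 0 < h) :
    ∃ a, x - h ≤ a ∧ a ≤ x ∧ ∀ t, 0 < t → t ≤ 2 * h →
      (∫ u in (x - h)..x, w u) / (4 * h) * t ≤ ∫ u in (a - t)..a, w u := by
  have hii : ∀ x y, IntervalIntegrable w volume x y :=
    fun x y => (hw.integrableOn_isCompact isCompact_uIcc).intervalIntegrable
  have hnn : ∀ y z, y ≤ z → 0 ≤ ∫ u in y..z, w u := fun y z hyz =>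
    intervalIntegral.integral_nonneg hyz fun t _ => (hw0 t).le
  set W := ∫ u in (x - h)..x, w u with hW
  have hW0 : 0 ≤ W := hnn _ _ (by linarith)
  set G : ℝ → ℝ := fun y => (∫ u in (x - h)..y, w u) - W / (2 * h) * (y - (x - h)) with hG
  have hGc : Continuous G := by
    have : Continuous fun y => ∫ u in (x - h)..y, w u :=
      intervalIntegral.continuous_primitive hii _
    fun_prop
  obtain ⟨a, ha, hmax⟩ := isCompact_Icc.exists_isMaxOn (s := Icc (x - h) x)
    ⟨x, by linarith, le_refl _⟩ hGc.continuousOn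
  have hle : ∀ z ∈ Icc (x - h) x, G z ≤ G a := fun z hz => hmax hz
  refine ⟨a, ha.1, ha.2, fun t ht0 ht => ?_⟩
  rcases le_total (x - h) (a - t) with hc | hc
  · have h1 := hle (a - t) ⟨hc, by linarith [ha.2]⟩
    have h2 := intervalIntegral.integral_interval_sub_left (hii (x - h) a) (hii (x - h) (a - t))
    simp only [hG] at h1
    have h3 : W / (2 * h) * t ≤ ∫ u in (a - t)..a, w u := by rw [← h2]; linarith
    refine le_trans ?_ h3
    gcongr
    linarith
  · have h1 := hle x ⟨by linarith, le_refl _⟩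
    have h2 : G x = W / 2 := by simp only [hG, ← hW]; field_simp; ring
    have h3 : W / 2 ≤ ∫ u in (x - h)..a, w u := by
      rw [h2] at h1
      simp only [hG] at h1
      have : 0 ≤ W / (2 * h) * (a - (x - h)) := mul_nonneg (by positivity) (by linarith [ha.1])
      linarith
    have h4 := intervalIntegral.integral_add_adjacent_intervals (hii (a - t) (x - h))
      (hii (x - h) a)
    have h5 := hnn (a - t) (x - h) hc
    have h6 : W / (4 * h) * t ≤ W / (4 * h) * (2 * h) := by gcongr
    have h7 : W / (4 * h) * (2 * h) = W / 2 := by field_simp; norm_num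
    linarith

theorem main_bound (w s : ℝ → ℝ) (hw : LocallyIntegrable w volume) (hw0 : ∀ x, 0 < w x)
    (hs : LocallyIntegrable s volume) (hs0 : ∀ x, 0 < s x) (hsm : Measurable s)
    (A K β : ℝ) (hK : 0 < K) (hA : 0 < A) (hβ : 0 < β) (hβ1 : β ≤ 1) (hβA : β ^ (-K) = 2 * A)
    (hws : ∀ x, w x = s x ^ (-K))
    (AP : ∀ x h : ℝ, 0 < h →
      (∫ t in (x - h)..x, w t) * (∫ t in x..(x + h), s t) ^ K ≤ A * h * h ^ K)
    (δ : ℝ) (hδ : 0 < δ) (hsmall : 2 * δ * (β⁻¹) ^ (1 + δ) ≤ 1 / 2)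
    (x h : ℝ) (hh : 0 < h) :
    ∫⁻ t in Ioc x (x + h), ENNReal.ofReal (s t ^ (1 + δ)) ≤
      ENNReal.ofReal (4 * h *
        ((4 * A * h / ∫ t in (x - h)..x, w t) ^ (1 / K)) ^ (1 + δ)) := by
  obtain ⟨a, ha1, ha2, hat⟩ := choose_a w hw hw0 x h hh
  have hii : ∀ x y, IntervalIntegrable w volume x y :=
    fun x y => (hw.integrableOn_isCompact isCompact_uIcc).intervalIntegrable
  set W := ∫ t in (x - h)..x, w t with hW
  have hWpos : 0 < W := intervalIntegral.intervalIntegral_pos_of_pos (hii _ _) hw0 (by linarith)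
  set M := (4 * A * h / W) ^ (1 / K) with hM
  have hMpos : 0 < M := by positivity
  have hMK : M ^ K = 4 * A * h / W := by
    rw [hM, ← Real.rpow_mul (by positivity), one_div_mul_cancel hK.ne', Real.rpow_one]
  have hMb : ∀ c ∈ Ioc a (x + h), ∫ t in a..c, s t ≤ M * (c - a) := by
    intro c hc
    have ht : 0 < c - a := sub_pos.2 hc.1
    have ht2 : c - a ≤ 2 * h := by linarith [hc.2]
    have h1 := AP a (c - a) ht
    rw [show a + (c - a) = c by ring] at h1
    have h2 := hat _ ht ht2
    set t := c - a with htd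
    have hsn : 0 ≤ ∫ u in a..c, s u :=
      intervalIntegral.integral_nonneg hc.1.le fun t _ => (hs0 t).le
    have h3 : W / (4 * h) * t * (∫ u in a..c, s u) ^ K ≤ A * t * t ^ K :=
      (mul_le_mul_of_nonneg_right h2 (Real.rpow_nonneg hsn K)).trans h1
    have h4 : (∫ u in a..c, s u) ^ K ≤ (M * t) ^ K := by
      rw [Real.mul_rpow hMpos.le ht.le, hMK]
      have hq : 0 < W / (4 * h) * t := by positivity
      refine le_of_mul_le_mul_left (h3.trans (le_of_eq ?_)) hq
      field_simp
    exact (Real.rpow_le_rpow_iff hsn (by positivity) hK).1 h4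
  have hRH := rev_holder w s hw hw0 hs hs0 hsm A K β hK hA hβ hβ1 hβA hws AP δ hδ hsmall a (x + h)
    M hMpos hMb
  have hax : a < x + h := by linarith
  rw [lint_Ioo s hs hs0 a (x + h) hax.le] at hRH
  calc ∫⁻ t in Ioc x (x + h), ENNReal.ofReal (s t ^ (1 + δ))
      = ∫⁻ t in Ioo x (x + h), ENNReal.ofReal (s t ^ (1 + δ)) :=
        setLIntegral_congr Ioo_ae_eq_Ioc.symm
    _ ≤ ∫⁻ t in Ioo a (x + h), ENNReal.ofReal (s t ^ (1 + δ)) :=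
        lintegral_mono_set (Ioo_subset_Ioo_left ha2)
    _ ≤ 2 * (ENNReal.ofReal (M ^ δ) * ENNReal.ofReal (∫ t in a..(x + h), s t)) := hRH
    _ ≤ 2 * (ENNReal.ofReal (M ^ δ) * ENNReal.ofReal (M * (2 * h))) := by
        gcongr
        refine (hMb (x + h) ⟨hax, le_refl _⟩).trans ?_
        gcongr
        linarith
    _ = ENNReal.ofReal (4 * h * M ^ (1 + δ)) := by
        rw [← ENNReal.ofReal_mul (by positivity), ← ENNReal.ofReal_ofNat,
          ← ENNReal.ofReal_mul (by norm_num), Real.rpow_add hMpos, Real.rpow_one]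
        congr 1; ring

theorem apPlusChar_congr (r : ℝ) (w w' : ℝ → ℝ) (h : w =ᵐ[volume] w') :
    apPlusChar r w = apPlusChar r w' := by
  have key : ∀ (f g : ℝ → ℝ), f =ᵐ[volume] g → ∀ a b, avgIoc f a b = avgIoc g a b := by
    intro f g hfg a b
    unfold avgIoc lintIoc
    congr 1
    apply lintegral_congr_ae
    filter_upwards [ae_restrict_of_ae hfg] with t ht
    rw [ht]
  unfold apPlusChar
  have h2 : (fun t => w t ^ (1 - r / (r - 1))) =ᵐ[volume] fun t => w' t ^ (1 - r / (r - 1)) := by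
    filter_upwards [h] with t ht
    rw [ht]
  simp only [key _ _ h, key _ _ h2]

theorem avgIoc_eq (f : ℝ → ℝ) (hf : LocallyIntegrable f volume) (hf0 : ∀ x, 0 < f x) (c d : ℝ)
    (hcd : c < d) : avgIoc f c d = ENNReal.ofReal ((d - c)⁻¹ * ∫ t in c..d, f t) := by
  unfold avgIoc lintIoc
  rw [lint_Ioc f hf hf0 c d hcd.le, ENNReal.ofReal_mul (inv_nonneg.2 (sub_pos.2 hcd).le),
    ENNReal.ofReal_inv_of_pos (sub_pos.2 hcd)]

theorem one_le_of_AP (w s : ℝ → ℝ) (hw : LocallyIntegrable w volume)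
    (hs : LocallyIntegrable s volume) (hs0 : ∀ x, 0 < s x)
    (A K : ℝ) (hK : 0 < K)
    (hws : ∀ x, w x = s x ^ (-K))
    (AP : ∀ x h : ℝ, 0 < h →
      (h⁻¹ * ∫ t in (x - h)..x, w t) * (h⁻¹ * ∫ t in x..(x + h), s t) ^ K ≤ A) : 1 ≤ A := by
  obtain ⟨x, hx1, hx2⟩ := ((_root_.LocallyIntegrable.ae_hasDerivAt_integral hw).and
    (_root_.LocallyIntegrable.ae_hasDerivAt_integral hs)).exists
  have h1 := (hx1 x).tendsto_slope_zero_left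
  have h2 := (hx2 x).tendsto_slope_zero_right
  simp only [intervalIntegral.integral_same, sub_zero, smul_eq_mul] at h1 h2
  have hneg : Tendsto (fun h : ℝ => -h) (nhdsWithin 0 (Ioi 0)) (nhdsWithin 0 (Iio 0)) := by
    simpa using tendsto_neg_nhdsGT (a := (0 : ℝ))
  have h3 := h1.comp hneg
  have h4 : Tendsto (fun h : ℝ => h⁻¹ * ∫ t in (x - h)..x, w t) (nhdsWithin 0 (Ioi 0))
      (nhds (w x)) := by
    refine h3.congr fun h => ?_
    simp only [Function.comp]
    rw [intervalIntegral.integral_symm, ← sub_eq_add_neg, inv_neg]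
    ring
  have h5 := h4.mul (h2.rpow_const (p := K) (Or.inr hK.le))
  have h6 : w x * s x ^ K = 1 := by
    rw [hws, Real.rpow_neg (hs0 x).le, inv_mul_cancel₀ (Real.rpow_pos_of_pos (hs0 x) K).ne']
  rw [h6] at h5
  refine le_of_tendsto h5 ?_
  filter_upwards [self_mem_nhdsWithin] with h hh
  exact AP x h hh

theorem core (p : ℝ) (hp : 1 < p) (w : ℝ → ℝ) (hwm : Measurable w) (hw0 : ∀ x, 0 < w x)
    (hw : LocallyIntegrable w volume) (hfin : apPlusChar p w ≠ ∞) :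
    ∃ ε : ℝ, 0 < ε ∧ ε < p - 1 ∧
      ENNReal.ofReal ((p - 1) * 2 ^ (-(1 / (p - 1))) / 32) * apPlusChar p w ^ (1 - p / (p - 1))
        = ENNReal.ofReal ε ∧
      apPlusChar (p - ε) w ≤ ENNReal.ofReal (4 ^ p) * apPlusChar p w := by
  obtain ⟨K, hKp⟩ : ∃ K, K = p - 1 := ⟨_, rfl⟩
  have hK : 0 < K := by linarith
  have hp' : p = K + 1 := by linarith
  have hexp : 1 - p / (p - 1) = -(1 / K) := by rw [← hKp, hp']; field_simp; ring
  rw [hexp, ← hKp]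
  set s : ℝ → ℝ := fun t => w t ^ (-(1 / K)) with hsdef
  have hsm : Measurable s := hwm.pow_const _
  have hs0 : ∀ x, 0 < s x := fun x => Real.rpow_pos_of_pos (hw0 x) _
  have hws : ∀ x, w x = s x ^ (-K) := by
    intro x
    simp only [hsdef]
    rw [← Real.rpow_mul (hw0 x).le, neg_mul_neg, one_div_mul_cancel hK.ne', Real.rpow_one]
  have hii : ∀ x y, IntervalIntegrable w volume x y :=
    fun x y => (hw.integrableOn_isCompact isCompact_uIcc).intervalIntegrable
  have hWpos : ∀ x h : ℝ, 0 < h → 0 < ∫ t in (x - h)..x, w t := fun x h hh =>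
    intervalIntegral.intervalIntegral_pos_of_pos (hii _ _) hw0 (by linarith)
  have hE : ∀ x h : ℝ, 0 < h →
      avgIoc w (x - h) x * avgIoc s x (x + h) ^ K ≤ apPlusChar p w := by
    intro x h hh
    unfold apPlusChar
    rw [hexp, ← hKp]
    exact le_iSup_of_le x (le_iSup_of_le h (le_iSup_of_le hh le_rfl))
  have hlint : ∀ x h : ℝ, 0 < h → IntegrableOn s (Ioc x (x + h)) volume := by
    intro x h hh
    have h1 : avgIoc w (x - h) x ≠ 0 := by
      rw [avgIoc_eq w hw hw0 _ _ (by linarith)]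
      rw [Ne, ENNReal.ofReal_eq_zero, not_le]
      have := hWpos x h hh
      rw [show x - (x - h) = h by ring]
      positivity
    have h2 : avgIoc s x (x + h) ≠ ∞ := by
      intro h3
      have := hE x h hh
      rw [h3, ENNReal.top_rpow_of_pos hK, ENNReal.mul_top h1] at this
      exact hfin (top_le_iff.1 this)
    have h4 : lintIoc s x (x + h) ≠ ∞ := by
      intro h5
      apply h2
      unfold avgIoc
      rw [h5, ENNReal.mul_top]
      simp
    refine ⟨hsm.aestronglyMeasurable, ?_⟩
    rw [hasFiniteIntegral_iff_ofReal (Eventually.of_forall fun t => (hs0 t).le)]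
    exact lt_top_iff_ne_top.2 h4
  have hs : LocallyIntegrable s volume := by
    intro x
    refine ⟨Ioc (x - 1) (x + 1), Ioc_mem_nhds (by linarith) (by linarith), ?_⟩
    have := hlint (x - 1) 2 (by norm_num)
    rwa [show x - 1 + 2 = x + 1 by ring] at this
  set A := (apPlusChar p w).toReal with hAdef
  have hAA : apPlusChar p w = ENNReal.ofReal A := (ENNReal.ofReal_toReal hfin).symm
  have AP1 : ∀ x h : ℝ, 0 < h →
      (h⁻¹ * ∫ t in (x - h)..x, w t) * (h⁻¹ * ∫ t in x..(x + h), s t) ^ K ≤ A := by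
    intro x h hh
    have h1 := hE x h hh
    have hW := hWpos x h hh
    have hS : 0 ≤ ∫ t in x..(x + h), s t :=
      intervalIntegral.integral_nonneg (by linarith) fun t _ => (hs0 t).le
    rw [avgIoc_eq w hw hw0 _ _ (by linarith), avgIoc_eq s hs hs0 _ _ (by linarith), hAA,
      ENNReal.ofReal_rpow_of_nonneg (by rw [add_sub_cancel_left]; positivity) hK.le,
      ← ENNReal.ofReal_mul (by rw [sub_sub_cancel]; positivity),
      ENNReal.ofReal_le_ofReal_iff ENNReal.toReal_nonneg, sub_sub_cancel, add_sub_cancel_left] at h1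
    exact h1
  have hA1 : 1 ≤ A := one_le_of_AP w s hw hs hs0 A K hK hws AP1
  have hA : 0 < A := by linarith
  have AP : ∀ x h : ℝ, 0 < h →
      (∫ t in (x - h)..x, w t) * (∫ t in x..(x + h), s t) ^ K ≤ A * h * h ^ K := by
    intro x h hh
    have h1 := AP1 x h hh
    have hS : 0 ≤ ∫ t in x..(x + h), s t :=
      intervalIntegral.integral_nonneg (by linarith) fun t _ => (hs0 t).le
    rw [Real.mul_rpow (by positivity) hS, Real.inv_rpow hh.le] at h1
    have hhK : 0 < h ^ K := Real.rpow_pos_of_pos hh K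
    have e : (h⁻¹ * ∫ t in (x - h)..x, w t) * ((h ^ K)⁻¹ * (∫ t in x..(x + h), s t) ^ K) =
      ((∫ t in (x - h)..x, w t) * (∫ t in x..(x + h), s t) ^ K) / (h * h ^ K) := by
      field_simp
    rw [e, div_le_iff₀ (by positivity)] at h1
    linarith
  set β := (2 * A) ^ (-(1 / K)) with hβdef
  have hβ : 0 < β := by positivity
  have hβ1 : β ≤ 1 := Real.rpow_le_one_of_one_le_of_nonpos (by linarith)
    (by have : 0 < 1 / K := by positivity
        linarith)
  have hβA : β ^ (-K) = 2 * A := by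
    rw [hβdef, ← Real.rpow_mul (by positivity), neg_mul_neg, one_div_mul_cancel hK.ne',
      Real.rpow_one]
  set η := β / 32 with hη
  have hη0 : 0 < η := by positivity
  have hη1 : η ≤ 1 / 32 := by rw [hη]; linarith
  have h1η : 0 < 1 - η := by linarith
  set δ := η / (1 - η) with hδd
  have hδ : 0 < δ := by positivity
  have hδ1 : 1 + δ = 1 / (1 - η) := by rw [hδd]; field_simp; ring
  have hδβ : δ ≤ β / 16 := by
    rw [hδd, div_le_iff₀ h1η, hη]
    nlinarith
  have hsmall : 2 * δ * (β⁻¹) ^ (1 + δ) ≤ 1 / 2 := by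
    have hB1 : 1 ≤ β⁻¹ := (one_le_inv₀ hβ).2 hβ1
    have hb := _root_.rpow_one_add_le_one_add_mul_self (s := β⁻¹ - 1) (by linarith)
      hδ.le (by linarith : δ ≤ 1)
    rw [show 1 + (β⁻¹ - 1) = β⁻¹ by ring] at hb
    have hdb : δ * β⁻¹ ≤ 1 / 16 := by
      calc δ * β⁻¹ ≤ β / 16 * β⁻¹ := by gcongr
        _ = 1 / 16 := by field_simp
    have hb2 : (β⁻¹) ^ δ ≤ 2 := by nlinarith
    rw [Real.rpow_add (by positivity), Real.rpow_one]
    calc 2 * δ * (β⁻¹ * β⁻¹ ^ δ) = 2 * (δ * β⁻¹) * β⁻¹ ^ δ := by ring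
      _ ≤ 2 * (1 / 16) * 2 := by gcongr
      _ ≤ _ := by norm_num
  refine ⟨K * η, by positivity, by nlinarith, ?_, ?_⟩
  · rw [hAA, ENNReal.ofReal_rpow_of_pos hA, ← ENNReal.ofReal_mul (by positivity), hη, hβdef,
      Real.mul_rpow (by norm_num) hA.le]
    congr 1; ring
  · unfold apPlusChar
    refine iSup_le fun x => iSup_le fun h => iSup_le fun hh => ?_
    change _ ≤ ENNReal.ofReal (4 ^ p) * apPlusChar p w
    have er : p - K * η - 1 = K * (1 - η) := by rw [hp']; ring
    have er2 : 1 - (p - K * η) / (p - K * η - 1) = -(1 / K) * (1 + δ) := by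
      rw [er, hδ1, hp']; field_simp; ring
    rw [er2, er]
    have efun : (fun t => w t ^ (-(1 / K) * (1 + δ))) = fun t => s t ^ (1 + δ) := by
      funext t
      rw [Real.rpow_mul (hw0 t).le]
    rw [efun]
    have hb := main_bound w s hw hw0 hs hs0 hsm A K β hK hA hβ hβ1 hβA hws AP δ hδ hsmall x h hh
    have hW := hWpos x h hh
    rw [avgIoc_eq w hw hw0 _ _ (by linarith), sub_sub_cancel]
    set W := ∫ t in (x - h)..x, w t with hWd
    set Y := 4 * A * h / W with hY
    have hYpos : 0 < Y := by positivity
    have hav : avgIoc (fun t => s t ^ (1 + δ)) x (x + h) ≤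
        ENNReal.ofReal (4 * (Y ^ (1 / K)) ^ (1 + δ)) := by
      unfold avgIoc lintIoc
      rw [add_sub_cancel_left, ← ENNReal.ofReal_inv_of_pos hh]
      calc _ ≤ ENNReal.ofReal h⁻¹ * ENNReal.ofReal (4 * h * (Y ^ (1 / K)) ^ (1 + δ)) := by gcongr
        _ = _ := by
          rw [← ENNReal.ofReal_mul (by positivity)]
          congr 1; field_simp
    have hq : 0 < K * (1 - η) := by positivity
    have h4 : (4 * (Y ^ (1 / K)) ^ (1 + δ)) ^ (K * (1 - η)) ≤ 4 ^ K * Y := by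
      rw [Real.mul_rpow (by norm_num) (by positivity), ← Real.rpow_mul hYpos.le,
        ← Real.rpow_mul hYpos.le]
      have e1 : 1 / K * (1 + δ) * (K * (1 - η)) = 1 := by rw [hδ1]; field_simp
      rw [e1, Real.rpow_one]
      gcongr
      · norm_num
      · nlinarith
    calc _ ≤ ENNReal.ofReal (h⁻¹ * W) *
          ENNReal.ofReal (4 * (Y ^ (1 / K)) ^ (1 + δ)) ^ (K * (1 - η)) := by
            gcongr
      _ = ENNReal.ofReal (h⁻¹ * W * (4 * (Y ^ (1 / K)) ^ (1 + δ)) ^ (K * (1 - η))) := by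
            rw [ENNReal.ofReal_rpow_of_pos (by positivity), ← ENNReal.ofReal_mul (by positivity)]
      _ ≤ ENNReal.ofReal (h⁻¹ * W * (4 ^ K * Y)) := by gcongr
      _ = ENNReal.ofReal (4 ^ p * A) := by
            congr 1
            rw [hY, hp', Real.rpow_add (by norm_num), Real.rpow_one]
            field_simp
      _ = _ := by rw [hAA, ENNReal.ofReal_mul (by positivity)]

/-- Openness of the one-sided Muckenhoupt condition with quantitative control:
if `w ∈ A_p^+(ℝ)` then `w ∈ A_{p-ε}^+(ℝ)` for some `ε ≍ ‖w‖_{A_p^+}^{1-p'}`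
(implied constants depending only on `p`), and `‖w‖_{A_{p-ε}^+} ≤ c ‖w‖_{A_p^+}`. -/
theorem stmt3 (p : ℝ) (hp : 1 < p) :
    ∃ c₁ c₂ c : ℝ, 0 < c₁ ∧ 0 < c₂ ∧ 0 < c ∧
      ∀ w : ℝ → ℝ, IsWeight w → apPlusChar p w ≠ ∞ →
        ∃ ε : ℝ, 0 < ε ∧ ε < p - 1 ∧
          ENNReal.ofReal c₁ * apPlusChar p w ^ (1 - p / (p - 1)) ≤ ENNReal.ofReal ε ∧
          ENNReal.ofReal ε ≤ ENNReal.ofReal c₂ * apPlusChar p w ^ (1 - p / (p - 1)) ∧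
          apPlusChar (p - ε) w ≠ ∞ ∧
          apPlusChar (p - ε) w ≤ ENNReal.ofReal c * apPlusChar p w := by
  have hK : 0 < p - 1 := by linarith
  have hc : 0 < (p - 1) * 2 ^ (-(1 / (p - 1))) / 32 := by positivity
  refine ⟨_, _, 4 ^ p, hc, hc, by positivity, ?_⟩
  intro w hw hfin
  obtain ⟨hpos, hloc⟩ := hw
  have hsm := hloc.aestronglyMeasurable
  set g := hsm.mk w with hg
  have hgm : Measurable g := hsm.stronglyMeasurable_mk.measurable
  set v : ℝ → ℝ := fun x => if 0 < g x then g x else 1 with hv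
  have hvm : Measurable v :=
    Measurable.ite (measurableSet_lt measurable_const hgm) hgm measurable_const
  have hv0 : ∀ x, 0 < v x := by
    intro x
    simp only [hv]
    split_ifs with h
    · exact h
    · norm_num
  have hwv : w =ᵐ[volume] v := by
    filter_upwards [hsm.ae_eq_mk, hpos] with x h1 h2
    have h3 : w x = g x := h1
    simp only [hv]
    rw [← h3, if_pos h2]
  have hvl : LocallyIntegrable v volume := by
    intro x
    obtain ⟨U, hU, hi⟩ := hloc x
    exact ⟨U, hU, hi.congr (ae_restrict_of_ae hwv)⟩
  simp only [fun r => apPlusChar_congr r w v hwv] at hfin ⊢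
  obtain ⟨ε, h1, h2, h3, h4⟩ := core p hp v hvm hv0 hvl hfin
  refine ⟨ε, h1, h2, h3.le, h3.ge, ?_, h4⟩
  exact ne_top_of_le_ne_top (ENNReal.mul_ne_top ENNReal.ofReal_ne_top hfin) h4

end
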